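/- arXiv:2406.14063 — 2 statements merged into one kernel-verified Lean document; each statement's English description precedes it below -/
import Mathlib

section
/- Let Ω ⊂ ℝⁿ (n ≥ 3) be a bounded open set, let γ be a conductivity on the closure of Ω, and let Ψ be a smooth diffeomorphism of the closure of Ω onto itself with |det DΨ(x)| = 1 for all x ∈ Ω. Let λ ∈ ℝ and let u be a C¹ function on the closure of Ω. Then u is a weak solution of −div((Ψ_*γ)∇u) = λu on Ω (i.e. ∫_Ω ((Ψ_*γ)∇u)·∇v dy = λ ∫_Ω u v dy for every smooth compactly supported v : Ω → ℝ) if and only if ũ := u∘Ψ is a weak solution of −div(γ∇ũ) = λũ on Ω (i.e. ∫_Ω (γ∇ũ)·∇w dx = λ ∫_Ω ũ w dx for every smooth compactly supported w : Ω → ℝ). -/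
open MeasureTheory Matrix Set Filter
open scoped Topology

noncomputable section

/-- The gradient of a scalar function on `ℝⁿ`, as a vector of partial derivatives. -/
def grad {n : ℕ} (u : (Fin n → ℝ) → ℝ) (x : Fin n → ℝ) : Fin n → ℝ :=
  fun i => fderiv ℝ u x (Pi.single i 1)

/-- The Jacobian matrix `(DΨ)_{ij} = ∂Ψ_i/∂x_j` of a map `Ψ : ℝⁿ → ℝⁿ`. -/
def Jac {n : ℕ} (Ψ : (Fin n → ℝ) → (Fin n → ℝ)) (x : Fin n → ℝ) :
    Matrix (Fin n) (Fin n) ℝ :=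
  Matrix.of fun i j => fderiv ℝ (fun y => Ψ y i) x (Pi.single j 1)

/-- A conductivity on a set `s`: a continuous map from `s` to the positive-definite
symmetric real `n × n` matrices. -/
def IsConductivityOn {n : ℕ} (γ : (Fin n → ℝ) → Matrix (Fin n) (Fin n) ℝ)
    (s : Set (Fin n → ℝ)) : Prop :=
  (∀ i j, ContinuousOn (fun x => γ x i j) s) ∧ ∀ x ∈ s, (γ x).IsSymm ∧ (γ x).PosDef

/-- The pushforward conductivity `Ψ_*γ = ((DΨ · γ · (DΨ)ᵀ)/|det DΨ|) ∘ Ψ⁻¹`, where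
`Φ` denotes the inverse of `Ψ`. -/
def pushforward {n : ℕ} (Ψ Φ : (Fin n → ℝ) → (Fin n → ℝ))
    (γ : (Fin n → ℝ) → Matrix (Fin n) (Fin n) ℝ) (y : Fin n → ℝ) :
    Matrix (Fin n) (Fin n) ℝ :=
  |(Jac Ψ (Φ y)).det|⁻¹ • (Jac Ψ (Φ y) * γ (Φ y) * (Jac Ψ (Φ y))ᵀ)

/-- A `C^k` diffeomorphism of the closure of `Ω` onto itself (restricting to a
diffeomorphism of `Ω` onto itself). -/
structure DiffeoOn {n : ℕ} (k : ℕ∞) (Ω : Set (Fin n → ℝ)) where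
  toFun : (Fin n → ℝ) → (Fin n → ℝ)
  invFun : (Fin n → ℝ) → (Fin n → ℝ)
  contDiffOn_toFun : ContDiffOn ℝ k toFun (closure Ω)
  contDiffOn_invFun : ContDiffOn ℝ k invFun (closure Ω)
  maps_toFun : MapsTo toFun (closure Ω) (closure Ω)
  maps_invFun : MapsTo invFun (closure Ω) (closure Ω)
  left_inv : ∀ x ∈ closure Ω, invFun (toFun x) = x
  right_inv : ∀ y ∈ closure Ω, toFun (invFun y) = y
  image_eq : toFun '' Ω = Ω

/-- A smooth test function compactly supported in `Ω`. -/
def IsTestFun {n : ℕ} (Ω : Set (Fin n → ℝ)) (v : (Fin n → ℝ) → ℝ) : Prop :=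
  ContDiff ℝ (⊤ : ℕ∞) v ∧ HasCompactSupport v ∧ tsupport v ⊆ Ω

/-- The divergence `div F = ∑ᵢ ∂Fᵢ/∂xᵢ` of a vector field on `ℝⁿ`. -/
def diverg {n : ℕ} (F : (Fin n → ℝ) → (Fin n → ℝ)) (x : Fin n → ℝ) : ℝ :=
  ∑ i, fderiv ℝ (fun y => F y i) x (Pi.single i 1)

/-- The Jacobian matrix is the matrix of the Fréchet derivative. -/
lemma jac_eq_toMatrix {n : ℕ} {F : (Fin n → ℝ) → (Fin n → ℝ)} {x : Fin n → ℝ}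
    (hF : DifferentiableAt ℝ F x) :
    Jac F x = LinearMap.toMatrix' (fderiv ℝ F x : (Fin n → ℝ) →ₗ[ℝ] (Fin n → ℝ)) := by
  ext i j
  rw [LinearMap.toMatrix'_apply, ContinuousLinearMap.coe_coe, Jac, Matrix.of_apply,
    (hasFDerivAt_pi'.1 hF.hasFDerivAt i).fderiv]
  simp

lemma det_fderiv_eq_det_jac {n : ℕ} {F : (Fin n → ℝ) → (Fin n → ℝ)} {x : Fin n → ℝ}
    (hF : DifferentiableAt ℝ F x) : (fderiv ℝ F x).det = (Jac F x).det := by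
  rw [jac_eq_toMatrix hF, LinearMap.det_toMatrix', ContinuousLinearMap.det]

/-- The chain rule for gradients. -/
lemma grad_comp {n : ℕ} {F : (Fin n → ℝ) → (Fin n → ℝ)} {f : (Fin n → ℝ) → ℝ}
    {x : Fin n → ℝ} (hF : DifferentiableAt ℝ F x) (hf : DifferentiableAt ℝ f (F x)) :
    grad (f ∘ F) x = (Jac F x)ᵀ *ᵥ grad f (F x) := by
  ext i
  have key : ∀ y : Fin n → ℝ, fderiv ℝ f (F x) y = ∑ j, y j * grad f (F x) j := by
    intro y
    conv_lhs => rw [pi_eq_sum_univ' y]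
    simp [grad]
  have hJ : ∀ j, Jac F x j i = fderiv ℝ F x (Pi.single i 1) j := by
    intro j
    rw [Jac, Matrix.of_apply, (hasFDerivAt_pi'.1 hF.hasFDerivAt j).fderiv]
    simp
  rw [grad, fderiv_comp x hf hF, ContinuousLinearMap.comp_apply, key]
  simp [Matrix.mulVec, dotProduct, hJ]

/-- The pushforward conductivity turns the Dirichlet form into its pullback, pointwise. -/
lemma congr_mulVec_dotProduct {n : ℕ} (J A : Matrix (Fin n) (Fin n) ℝ) (g h : Fin n → ℝ) :
    (J * A * Jᵀ) *ᵥ g ⬝ᵥ h = A *ᵥ (Jᵀ *ᵥ g) ⬝ᵥ (Jᵀ *ᵥ h) := by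
  rw [← Matrix.mulVec_mulVec, ← Matrix.mulVec_mulVec, Matrix.dotProduct_mulVec,
    Matrix.vecMul_transpose]

/-- The pullback of a test function by a smooth map with continuous inverse, extended by zero,
is a test function. -/
lemma IsTestFun.indicator_comp {n : ℕ} {Ω : Set (Fin n → ℝ)} (hΩ : IsOpen Ω)
    {F G : (Fin n → ℝ) → (Fin n → ℝ)} (hF : ContDiffOn ℝ (⊤ : ℕ∞) F Ω) (hG : ContinuousOn G Ω)
    (hGΩ : MapsTo G Ω Ω) (hGF : ∀ x ∈ Ω, G (F x) = x)
    {v : (Fin n → ℝ) → ℝ} (hv : IsTestFun Ω v) : IsTestFun Ω (Ω.indicator (v ∘ F)) := by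
  obtain ⟨hv, hvc, hvΩ⟩ := hv
  have hK : IsCompact (G '' tsupport v) := hvc.isCompact.image_of_continuousOn (hG.mono hvΩ)
  have hKΩ : G '' tsupport v ⊆ Ω := (hGΩ.mono_left hvΩ).image_subset
  have hsupp : Function.support (Ω.indicator (v ∘ F)) ⊆ G '' tsupport v := by
    intro x hx
    rw [Set.support_indicator] at hx
    exact ⟨F x, subset_tsupport v hx.2, hGF x hx.1⟩
  have htsupp : tsupport (Ω.indicator (v ∘ F)) ⊆ G '' tsupport v :=
    closure_minimal hsupp hK.isClosed
  refine ⟨contDiff_iff_contDiffAt.2 fun x => ?_,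
    hK.of_isClosed_subset (isClosed_tsupport _) htsupp, htsupp.trans hKΩ⟩
  by_cases hx : x ∈ Ω
  · refine (hv.contDiffAt.comp x (hF.contDiffAt (hΩ.mem_nhds hx))).congr_of_eventuallyEq ?_
    filter_upwards [hΩ.mem_nhds hx] with y hy
    exact Set.indicator_of_mem hy _
  · refine (contDiffAt_const (c := (0 : ℝ))).congr_of_eventuallyEq ?_
    exact notMem_tsupport_iff_eventuallyEq.1 fun h => hx (hKΩ (htsupp h))

namespace DiffeoOn

variable {n : ℕ} {k : ℕ∞} {Ω : Set (Fin n → ℝ)}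

lemma mapsTo_toFun (Ψ : DiffeoOn k Ω) : MapsTo Ψ.toFun Ω Ω := fun _ hx =>
  Ψ.image_eq.le (mem_image_of_mem _ hx)

lemma invFun_toFun (Ψ : DiffeoOn k Ω) {x : Fin n → ℝ} (hx : x ∈ Ω) :
    Ψ.invFun (Ψ.toFun x) = x :=
  Ψ.left_inv x (subset_closure hx)

lemma toFun_invFun (Ψ : DiffeoOn k Ω) {y : Fin n → ℝ} (hy : y ∈ Ω) :
    Ψ.toFun (Ψ.invFun y) = y :=
  Ψ.right_inv y (subset_closure hy)

lemma mapsTo_invFun (Ψ : DiffeoOn k Ω) : MapsTo Ψ.invFun Ω Ω := by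
  intro y hy
  obtain ⟨x, hx, rfl⟩ := Ψ.image_eq.ge hy
  rwa [Ψ.invFun_toFun hx]

lemma differentiableAt_toFun (Ψ : DiffeoOn ⊤ Ω) (hΩ : IsOpen Ω) {x : Fin n → ℝ} (hx : x ∈ Ω) :
    DifferentiableAt ℝ Ψ.toFun x :=
  ((Ψ.contDiffOn_toFun.mono subset_closure).contDiffAt (hΩ.mem_nhds hx)).differentiableAt
    (by simp)

/-- Change of variables for a volume-preserving diffeomorphism. -/
lemma setIntegral_comp (Ψ : DiffeoOn ⊤ Ω) (hΩ : IsOpen Ω)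
    (hdet : ∀ x ∈ Ω, |(Jac Ψ.toFun x).det| = 1) (g : (Fin n → ℝ) → ℝ) :
    ∫ y in Ω, g y = ∫ x in Ω, g (Ψ.toFun x) := by
  have hinj : InjOn Ψ.toFun Ω := fun x hx y hy h => by
    rw [← Ψ.invFun_toFun hx, h, Ψ.invFun_toFun hy]
  conv_lhs => rw [← Ψ.image_eq]
  rw [integral_image_eq_integral_abs_det_fderiv_smul volume hΩ.measurableSet
    (fun x hx => (Ψ.differentiableAt_toFun hΩ hx).hasFDerivAt.hasFDerivWithinAt) hinj]
  refine setIntegral_congr_fun hΩ.measurableSet fun x hx => ?_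
  simp only [det_fderiv_eq_det_jac (Ψ.differentiableAt_toFun hΩ hx), hdet x hx, one_smul]

/-- The Dirichlet form of the pushforward conductivity is the pullback Dirichlet form. -/
lemma setIntegral_pushforward (Ψ : DiffeoOn ⊤ Ω) (hΩ : IsOpen Ω)
    (hdet : ∀ x ∈ Ω, |(Jac Ψ.toFun x).det| = 1)
    (γ : (Fin n → ℝ) → Matrix (Fin n) (Fin n) ℝ) {u v w : (Fin n → ℝ) → ℝ}
    (hu : ∀ y ∈ Ω, DifferentiableAt ℝ u y) (hv : ∀ y ∈ Ω, DifferentiableAt ℝ v y)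
    (hw : ∀ x ∈ Ω, w x = v (Ψ.toFun x)) :
    ∫ y in Ω, (pushforward Ψ.toFun Ψ.invFun γ y).mulVec (grad u y) ⬝ᵥ grad v y
      = ∫ x in Ω, (γ x).mulVec (grad (u ∘ Ψ.toFun) x) ⬝ᵥ grad w x := by
  rw [Ψ.setIntegral_comp hΩ hdet]
  refine setIntegral_congr_fun hΩ.measurableSet fun x hx => ?_
  have hΨ := Ψ.differentiableAt_toFun hΩ hx
  have hgw : grad w x = grad (v ∘ Ψ.toFun) x := by
    have : w =ᶠ[𝓝 x] v ∘ Ψ.toFun := by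
      filter_upwards [hΩ.mem_nhds hx] with z hz using hw z hz
    ext i
    simp only [grad, this.fderiv_eq]
  simp only [pushforward, Ψ.invFun_toFun hx, hdet x hx, inv_one, one_smul, hgw,
    grad_comp hΨ (hu _ (Ψ.mapsTo_toFun hx)), grad_comp hΨ (hv _ (Ψ.mapsTo_toFun hx)),
    congr_mulVec_dotProduct]

end DiffeoOn

/-- For a volume-preserving smooth diffeomorphism `Ψ` of the closure
of `Ω` onto itself (`|det DΨ| = 1` on `Ω`), a `C¹` function `u` is a weak solution of
`−div((Ψ_*γ)∇u) = λu` on `Ω` if and only if `ũ := u ∘ Ψ` is a weak solution of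
`−div(γ∇ũ) = λũ` on `Ω`. -/
theorem weak_solution_pullback_unimodular_iff
    {n : ℕ} (hn : 3 ≤ n) (Ω : Set (Fin n → ℝ)) (hΩo : IsOpen Ω)
    (hΩb : Bornology.IsBounded Ω)
    (γ : (Fin n → ℝ) → Matrix (Fin n) (Fin n) ℝ)
    (hγ : IsConductivityOn γ (closure Ω))
    (Ψ : DiffeoOn ⊤ Ω)
    (hdet : ∀ x ∈ Ω, |(Jac Ψ.toFun x).det| = 1)
    (lam : ℝ)
    (u : (Fin n → ℝ) → ℝ) (hu : ContDiffOn ℝ 1 u (closure Ω)) :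
    (∀ v : (Fin n → ℝ) → ℝ, IsTestFun Ω v →
      ∫ y in Ω, (pushforward Ψ.toFun Ψ.invFun γ y).mulVec (grad u y) ⬝ᵥ grad v y
        = lam * ∫ y in Ω, u y * v y)
    ↔ (∀ w : (Fin n → ℝ) → ℝ, IsTestFun Ω w →
      ∫ x in Ω, (γ x).mulVec (grad (u ∘ Ψ.toFun) x) ⬝ᵥ grad w x
        = lam * ∫ x in Ω, u (Ψ.toFun x) * w x) := by
  have hu' : ∀ y ∈ Ω, DifferentiableAt ℝ u y := fun y hy =>
    ((hu.mono subset_closure).contDiffAt (hΩo.mem_nhds hy)).differentiableAt one_ne_zero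
  have hΨ := Ψ.contDiffOn_toFun.mono subset_closure
  have hΦ := Ψ.contDiffOn_invFun.mono subset_closure
  have weak_iff : ∀ v w : (Fin n → ℝ) → ℝ, IsTestFun Ω v → (∀ x ∈ Ω, w x = v (Ψ.toFun x)) →
      ((∫ y in Ω, (pushforward Ψ.toFun Ψ.invFun γ y).mulVec (grad u y) ⬝ᵥ grad v y
          = lam * ∫ y in Ω, u y * v y)
        ↔ ∫ x in Ω, (γ x).mulVec (grad (u ∘ Ψ.toFun) x) ⬝ᵥ grad w x
          = lam * ∫ x in Ω, u (Ψ.toFun x) * w x) := by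
    intro v w hv hw
    have hmass : ∫ y in Ω, u y * v y = ∫ x in Ω, u (Ψ.toFun x) * w x := by
      rw [Ψ.setIntegral_comp hΩo hdet]
      exact setIntegral_congr_fun hΩo.measurableSet fun x hx => by simp only [hw x hx]
    rw [Ψ.setIntegral_pushforward hΩo hdet γ hu'
      (fun y _ => hv.1.contDiffAt.differentiableAt (by simp)) hw, hmass]
  constructor
  · intro h w hw
    have hv := hw.indicator_comp hΩo hΦ hΨ.continuousOn Ψ.mapsTo_toFun
      fun y hy => Ψ.toFun_invFun hy
    refine (weak_iff _ w hv fun x hx => ?_).1 (h _ hv)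
    rw [Set.indicator_of_mem (Ψ.mapsTo_toFun hx), Function.comp_apply, Ψ.invFun_toFun hx]
  · intro h v hv
    have hw := hv.indicator_comp hΩo hΨ hΦ.continuousOn Ψ.mapsTo_invFun
      fun x hx => Ψ.invFun_toFun hx
    exact (weak_iff v _ hv fun x hx => Set.indicator_of_mem hx _).2 (h _ hw)
end
end

section
/- Let Ω ⊂ ℝⁿ (n ≥ 3) be a bounded open set, let γ be a C¹ conductivity on the closure of Ω, let λ ∈ ℝ, let f : Ω → ℝ be continuous, and let c, v be C² functions on the closure of Ω with c > 0. Assume that −div(c² γ ∇v) = λ v on Ω and that div(γ ∇c) + λ ( c − 1/c + c f ) = 0 on Ω. Let Ψ be a smooth diffeomorphism of the closure of Ω onto itself with |det DΨ(x)| = 1 + f(x) for all x ∈ Ω. Then the function w := (c v) ∘ Ψ⁻¹ is a weak solution of −div((Ψ_*γ) ∇w) = λ w on Ω, i.e. ∫_Ω ((Ψ_*γ)∇w)·∇φ dy = λ ∫_Ω w φ dy for every smooth compactly supported φ : Ω → ℝ. -/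
open MeasureTheory Matrix Set Filter
open scoped Topology

noncomputable section

theorem fderiv_apply_eq_grad_dotProduct {n : ℕ} (u : (Fin n → ℝ) → ℝ) (x w : Fin n → ℝ) :
    fderiv ℝ u x w = grad u x ⬝ᵥ w := by
  conv_lhs => rw [pi_eq_sum_univ' w]
  simp only [map_sum, map_smul, smul_eq_mul, dotProduct, grad]
  exact Finset.sum_congr rfl fun i _ => mul_comm _ _

theorem grad_mul {n : ℕ} {u v : (Fin n → ℝ) → ℝ} {x : Fin n → ℝ}
    (hu : DifferentiableAt ℝ u x) (hv : DifferentiableAt ℝ v x) :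
    grad (fun y => u y * v y) x = u x • grad v x + v x • grad u x := by
  ext i
  simp [grad, fderiv_fun_mul hu hv]

theorem Filter.EventuallyEq.grad_eq {n : ℕ} {u v : (Fin n → ℝ) → ℝ} {x : Fin n → ℝ}
    (h : u =ᶠ[𝓝 x] v) : grad u x = grad v x := by
  ext i
  simp [grad, h.fderiv_eq]

theorem diverg_add {n : ℕ} {F G : (Fin n → ℝ) → (Fin n → ℝ)} {x : Fin n → ℝ}
    (hF : DifferentiableAt ℝ F x) (hG : DifferentiableAt ℝ G x) :
    diverg (fun y => F y + G y) x = diverg F x + diverg G x := by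
  rw [differentiableAt_pi] at hF hG
  simp only [diverg, Pi.add_apply, ← Finset.sum_add_distrib]
  refine Finset.sum_congr rfl fun i _ => ?_
  rw [fderiv_fun_add (hF i) (hG i), _root_.add_apply]

theorem diverg_smul {n : ℕ} {a : (Fin n → ℝ) → ℝ} {F : (Fin n → ℝ) → (Fin n → ℝ)}
    {x : Fin n → ℝ} (ha : DifferentiableAt ℝ a x) (hF : DifferentiableAt ℝ F x) :
    diverg (fun y => a y • F y) x = a x * diverg F x + grad a x ⬝ᵥ F x := by
  rw [differentiableAt_pi] at hF
  simp only [diverg, Pi.smul_apply, smul_eq_mul, Finset.mul_sum, dotProduct, grad,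
    ← Finset.sum_add_distrib]
  refine Finset.sum_congr rfl fun i _ => ?_
  rw [fderiv_fun_mul ha (hF i)]
  simp [mul_comm]

theorem Filter.EventuallyEq.diverg_eq {n : ℕ} {F G : (Fin n → ℝ) → (Fin n → ℝ)}
    {x : Fin n → ℝ} (h : F =ᶠ[𝓝 x] G) : diverg F x = diverg G x := by
  refine Finset.sum_congr rfl fun i _ => ?_
  have : (fun y => F y i) =ᶠ[𝓝 x] fun y => G y i := h.mono fun y hy => by simp only [hy]
  rw [this.fderiv_eq]

theorem Jac_eq_toMatrix' {n : ℕ} {Ψ : (Fin n → ℝ) → (Fin n → ℝ)} {x : Fin n → ℝ}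
    (hΨ : DifferentiableAt ℝ Ψ x) :
    Jac Ψ x = LinearMap.toMatrix' (fderiv ℝ Ψ x : (Fin n → ℝ) →ₗ[ℝ] (Fin n → ℝ)) := by
  ext i j
  rw [LinearMap.toMatrix'_apply, Jac, Matrix.of_apply, fderiv_apply hΨ]
  simp

theorem det_Jac {n : ℕ} {Ψ : (Fin n → ℝ) → (Fin n → ℝ)} {x : Fin n → ℝ}
    (hΨ : DifferentiableAt ℝ Ψ x) : (Jac Ψ x).det = (fderiv ℝ Ψ x).det := by
  rw [Jac_eq_toMatrix' hΨ, LinearMap.det_toMatrix', ContinuousLinearMap.det]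

theorem grad_comp_s5 {n : ℕ} {u : (Fin n → ℝ) → ℝ} {Ψ : (Fin n → ℝ) → (Fin n → ℝ)}
    {x : Fin n → ℝ} (hu : DifferentiableAt ℝ u (Ψ x)) (hΨ : DifferentiableAt ℝ Ψ x) :
    grad (fun y => u (Ψ y)) x = (Jac Ψ x)ᵀ *ᵥ grad u (Ψ x) := by
  ext j
  have h : fderiv ℝ (fun y => u (Ψ y)) x = (fderiv ℝ u (Ψ x)).comp (fderiv ℝ Ψ x) :=
    fderiv_comp x hu hΨ
  rw [grad, h, ContinuousLinearMap.comp_apply, fderiv_apply_eq_grad_dotProduct,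
    Matrix.mulVec_transpose, Matrix.vecMul, Jac_eq_toMatrix' hΨ]
  congr 1

theorem ContDiffOn.grad {n : ℕ} {u : (Fin n → ℝ) → ℝ} {s : Set (Fin n → ℝ)}
    (hs : IsOpen s) (hu : ContDiffOn ℝ 2 u s) : ContDiffOn ℝ 1 (grad u) s := by
  rw [contDiffOn_pi]
  intro i
  exact (hu.fderiv_of_isOpen hs (by norm_num)).clm_apply contDiffOn_const

theorem ContDiffOn.mulVec {n : ℕ} {k : WithTop ℕ∞} {E : Type*} [NormedAddCommGroup E]
    [NormedSpace ℝ E] {A : E → Matrix (Fin n) (Fin n) ℝ} {F : E → (Fin n → ℝ)} {s : Set E}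
    (hA : ∀ i j, ContDiffOn ℝ k (fun x => A x i j) s) (hF : ContDiffOn ℝ k F s) :
    ContDiffOn ℝ k (fun x => A x *ᵥ F x) s := by
  rw [contDiffOn_pi] at hF ⊢
  intro i
  simp only [Matrix.mulVec, dotProduct]
  exact ContDiffOn.sum fun j _ => (hA i j).mul (hF j)

/-- The divergence theorem for a `C¹` field on an open set, tested against a `C¹` function
compactly supported in it. -/
theorem setIntegral_dotProduct_grad {n : ℕ} {Ω : Set (Fin n → ℝ)} (hΩ : IsOpen Ω)
    {F : (Fin n → ℝ) → (Fin n → ℝ)} (hF : ContDiffOn ℝ 1 F Ω)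
    {ψ : (Fin n → ℝ) → ℝ} (hψ : ContDiff ℝ 1 ψ) (hψc : HasCompactSupport ψ)
    (hψs : tsupport ψ ⊆ Ω) :
    ∫ x in Ω, F x ⬝ᵥ grad ψ x = -∫ x in Ω, diverg F x * ψ x := by
  have hFi (i : Fin n) : ContDiffOn ℝ 1 (fun x => F x i) Ω := contDiffOn_pi.1 hF i
  have integrable_of_zero {g : (Fin n → ℝ) → ℝ} (hg : ContinuousOn g Ω)
      (h0 : ∀ x ∉ tsupport ψ, g x = 0) : Integrable g := by
    rw [← integrableOn_univ]
    exact ((hg.mono hψs).integrableOn_compact hψc).of_forall_sdiff_eq_zero MeasurableSet.univ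
      fun x hx => h0 x hx.2
  have grad_zero (i : Fin n) (x) (hx : x ∉ tsupport ψ) : fderiv ℝ ψ x (Pi.single i 1) = 0 := by
    rw [fderiv_of_notMem_tsupport ℝ hx, _root_.zero_apply]
  have psi_zero (x) (hx : x ∉ tsupport ψ) : ψ x = 0 := image_eq_zero_of_notMem_tsupport hx
  have int_grad (i : Fin n) : Integrable fun x => F x i * fderiv ℝ ψ x (Pi.single i 1) :=
    integrable_of_zero ((hFi i).continuousOn.mul
      ((hψ.continuous_fderiv one_ne_zero).clm_apply continuous_const).continuousOn)
      fun x hx => by rw [grad_zero i x hx, mul_zero]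
  have int_div (i : Fin n) :
      Integrable fun x => fderiv ℝ (fun y => F y i) x (Pi.single i 1) * ψ x :=
    integrable_of_zero ((((hFi i).continuousOn_fderiv_of_isOpen hΩ le_rfl).clm_apply
      continuousOn_const).mul hψ.continuous.continuousOn)
      fun x hx => by rw [psi_zero x hx, mul_zero]
  have int_mul (i : Fin n) : Integrable fun x => F x i * ψ x :=
    integrable_of_zero ((hFi i).continuousOn.mul hψ.continuous.continuousOn)
      fun x hx => by rw [psi_zero x hx, mul_zero]
  rw [setIntegral_eq_integral_of_forall_compl_eq_zero,
    setIntegral_eq_integral_of_forall_compl_eq_zero]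
  · simp only [dotProduct, grad, diverg, Finset.sum_mul]
    rw [integral_finsetSum _ fun i _ => int_grad i, integral_finsetSum _ fun i _ => int_div i,
      ← Finset.sum_neg_distrib]
    refine Finset.sum_congr rfl fun i _ =>
      integral_mul_fderiv_eq_neg_fderiv_mul_of_integrable (int_div i) (int_grad i) (int_mul i)
        (fun x hx => ?_) fun x _ => hψ.differentiable one_ne_zero x
    exact ((hFi i).contDiffAt (hΩ.mem_nhds (hψs hx))).differentiableAt one_ne_zero
  · intro x hx
    rw [psi_zero x fun h => hx (hψs h), mul_zero]
  · intro x hx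
    exact Finset.sum_eq_zero fun i _ => by
      rw [grad, grad_zero i x fun h => hx (hψs h), mul_zero]

theorem contDiff_indicator_of_eq_zero {E : Type*} [NormedAddCommGroup E] [NormedSpace ℝ E]
    {k : WithTop ℕ∞} {g : E → ℝ} {s K : Set E} (hs : IsOpen s) (hg : ContDiffOn ℝ k g s)
    (hK : IsClosed K) (hKs : K ⊆ s) (h0 : ∀ x ∈ s, x ∉ K → g x = 0) :
    ContDiff ℝ k (s.indicator g) ∧ tsupport (s.indicator g) ⊆ K := by
  have hz : ∀ x ∉ K, s.indicator g x = 0 := fun x hx => by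
    by_cases hxs : x ∈ s
    · rw [indicator_of_mem hxs, h0 x hxs hx]
    · exact indicator_of_notMem hxs g
  refine ⟨contDiff_iff_contDiffAt.2 fun x => ?_,
    closure_minimal (fun x hx => by_contra fun h => hx (hz x h)) hK⟩
  by_cases hx : x ∈ K
  · have hxs := hs.mem_nhds (hKs hx)
    exact (hg.contDiffAt hxs).congr_of_eventuallyEq
      (mem_of_superset hxs fun y hy => indicator_of_mem hy g)
  · exact contDiffAt_const.congr_of_eventuallyEq
      (mem_of_superset (hK.isOpen_compl.mem_nhds hx) hz)

theorem DiffeoOn.apply_mem {n : ℕ} {k : ℕ∞} {Ω : Set (Fin n → ℝ)} (Ψ : DiffeoOn k Ω)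
    {x : Fin n → ℝ} (hx : x ∈ Ω) : Ψ.toFun x ∈ Ω :=
  Ψ.image_eq.subset (mem_image_of_mem Ψ.toFun hx)

theorem DiffeoOn.inv_apply_mem {n : ℕ} {k : ℕ∞} {Ω : Set (Fin n → ℝ)} (Ψ : DiffeoOn k Ω)
    {y : Fin n → ℝ} (hy : y ∈ Ω) : Ψ.invFun y ∈ Ω := by
  rw [← Ψ.image_eq] at hy
  obtain ⟨x, hx, rfl⟩ := hy
  rwa [Ψ.left_inv x (subset_closure hx)]

theorem DiffeoOn.contDiffAt_toFun {n : ℕ} {k : ℕ∞} {Ω : Set (Fin n → ℝ)} (Ψ : DiffeoOn k Ω)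
    (hΩ : IsOpen Ω) {x : Fin n → ℝ} (hx : x ∈ Ω) : ContDiffAt ℝ k Ψ.toFun x :=
  Ψ.contDiffOn_toFun.contDiffAt (mem_of_superset (hΩ.mem_nhds hx) subset_closure)

theorem DiffeoOn.contDiffAt_invFun {n : ℕ} {k : ℕ∞} {Ω : Set (Fin n → ℝ)} (Ψ : DiffeoOn k Ω)
    (hΩ : IsOpen Ω) {y : Fin n → ℝ} (hy : y ∈ Ω) : ContDiffAt ℝ k Ψ.invFun y :=
  Ψ.contDiffOn_invFun.contDiffAt (mem_of_superset (hΩ.mem_nhds hy) subset_closure)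

theorem DiffeoOn.det_Jac_ne_zero {n : ℕ} {k : ℕ∞} {Ω : Set (Fin n → ℝ)} (Ψ : DiffeoOn k Ω)
    (hk : k ≠ 0) (hΩ : IsOpen Ω) {x : Fin n → ℝ} (hx : x ∈ Ω) :
    (Jac Ψ.toFun x).det ≠ 0 := by
  have hk' : (k : WithTop ℕ∞) ≠ 0 := by exact_mod_cast hk
  have hΨ := (Ψ.contDiffAt_toFun hΩ hx).differentiableAt hk'
  have hΦ := (Ψ.contDiffAt_invFun hΩ (Ψ.apply_mem hx)).differentiableAt hk'
  have hid : Ψ.invFun ∘ Ψ.toFun =ᶠ[𝓝 x] id :=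
    mem_of_superset (hΩ.mem_nhds hx) fun y hy => Ψ.left_inv y (subset_closure hy)
  have h := fderiv_comp x hΦ hΨ
  rw [hid.fderiv_eq, fderiv_id] at h
  have hdet := congrArg (fun L : (Fin n → ℝ) →L[ℝ] (Fin n → ℝ) => LinearMap.det L.toLinearMap) h
  rw [det_Jac hΨ]
  intro h0
  rw [ContinuousLinearMap.det] at h0
  simp [h0] at hdet

/-- Change of variables for a diffeomorphism of an open set. -/
theorem DiffeoOn.setIntegral_eq {n : ℕ} {k : ℕ∞} {Ω : Set (Fin n → ℝ)} (Ψ : DiffeoOn k Ω)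
    (hk : k ≠ 0) (hΩ : IsOpen Ω) (g : (Fin n → ℝ) → ℝ) :
    ∫ y in Ω, g y = ∫ x in Ω, |(Jac Ψ.toFun x).det| * g (Ψ.toFun x) := by
  have hk' : (k : WithTop ℕ∞) ≠ 0 := by exact_mod_cast hk
  have hΨ (x) (hx : x ∈ Ω) := (Ψ.contDiffAt_toFun hΩ hx).differentiableAt hk'
  have hinj : InjOn Ψ.toFun Ω := fun x hx y hy h => by
    rw [← Ψ.left_inv x (subset_closure hx), h, Ψ.left_inv y (subset_closure hy)]
  conv_lhs => rw [← Ψ.image_eq]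
  rw [integral_image_eq_integral_abs_det_fderiv_smul volume hΩ.measurableSet
    (fun x hx => (hΨ x hx).hasFDerivAt.hasFDerivWithinAt) hinj]
  refine setIntegral_congr_fun hΩ.measurableSet fun x hx => ?_
  simp only [det_Jac (hΨ x hx), smul_eq_mul]

/-- Pulling back a conductivity equation by a diffeomorphism. -/
theorem DiffeoOn.abs_det_mul_pushforward_dotProduct {n : ℕ} {k : ℕ∞} {Ω : Set (Fin n → ℝ)}
    (Ψ : DiffeoOn k Ω) (hk : k ≠ 0) (hΩ : IsOpen Ω)
    (γ : (Fin n → ℝ) → Matrix (Fin n) (Fin n) ℝ) {w φ : (Fin n → ℝ) → ℝ} {x : Fin n → ℝ}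
    (hx : x ∈ Ω) (hw : DifferentiableAt ℝ w (Ψ.toFun x))
    (hφ : DifferentiableAt ℝ φ (Ψ.toFun x)) :
    |(Jac Ψ.toFun x).det| * (pushforward Ψ.toFun Ψ.invFun γ (Ψ.toFun x) *ᵥ grad w (Ψ.toFun x)
        ⬝ᵥ grad φ (Ψ.toFun x))
      = γ x *ᵥ grad (fun z => w (Ψ.toFun z)) x ⬝ᵥ grad (fun z => φ (Ψ.toFun z)) x := by
  have hΨ := (Ψ.contDiffAt_toFun hΩ hx).differentiableAt
    (by exact_mod_cast hk : (k : WithTop ℕ∞) ≠ 0)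
  have hdet := abs_ne_zero.2 (Ψ.det_Jac_ne_zero hk hΩ hx)
  rw [grad_comp_s5 hw hΨ, grad_comp_s5 hφ hΨ, pushforward, Ψ.left_inv x (subset_closure hx),
    Matrix.smul_mulVec, smul_dotProduct, smul_eq_mul, mul_inv_cancel_left₀ hdet,
    ← Matrix.mulVec_mulVec, ← Matrix.mulVec_mulVec, Matrix.mulVec_transpose _ (grad φ _),
    dotProduct_comm _ (grad φ _ ᵥ* _), ← Matrix.dotProduct_mulVec, dotProduct_comm]

/-- The pullback of a test function, extended by zero, is again a test function. -/
theorem DiffeoOn.contDiff_indicator_comp {n : ℕ} {k : ℕ∞} {Ω : Set (Fin n → ℝ)}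
    (Ψ : DiffeoOn k Ω) (hΩ : IsOpen Ω) {φ : (Fin n → ℝ) → ℝ} (hφ : IsTestFun Ω φ) :
    ContDiff ℝ k (Ω.indicator fun x => φ (Ψ.toFun x)) ∧
      HasCompactSupport (Ω.indicator fun x => φ (Ψ.toFun x)) ∧
      tsupport (Ω.indicator fun x => φ (Ψ.toFun x)) ⊆ Ω := by
  obtain ⟨hφd, hφc, hφs⟩ := hφ
  have hK : IsCompact (Ψ.invFun '' tsupport φ) :=
    hφc.isCompact.image_of_continuousOn
      (Ψ.contDiffOn_invFun.continuousOn.mono (hφs.trans subset_closure))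
  have hKΩ : Ψ.invFun '' tsupport φ ⊆ Ω := by
    rintro _ ⟨y, hy, rfl⟩
    exact Ψ.inv_apply_mem (hφs hy)
  obtain ⟨h, hsupp⟩ := contDiff_indicator_of_eq_zero (g := fun x => φ (Ψ.toFun x)) hΩ
    ((hφd.of_le (by exact_mod_cast le_top)).comp_contDiffOn
      (Ψ.contDiffOn_toFun.mono subset_closure)) hK.isClosed hKΩ fun x hx hxK =>
        image_eq_zero_of_notMem_tsupport fun h =>
          hxK ⟨_, h, Ψ.left_inv x (subset_closure hx)⟩
  exact ⟨h, hK.of_isClosed_subset (isClosed_tsupport _) hsupp, hsupp.trans hKΩ⟩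

/-- `div (γ ∇(cv))` in terms of `div (γ ∇c)` and `div (c² γ ∇v)`. -/
theorem diverg_mulVec_grad_mul {n : ℕ} {Ω : Set (Fin n → ℝ)} (hΩ : IsOpen Ω)
    {γ : (Fin n → ℝ) → Matrix (Fin n) (Fin n) ℝ}
    (hγ : ∀ i j, ContDiffOn ℝ 1 (fun x => γ x i j) Ω) (hsymm : ∀ x ∈ Ω, (γ x).IsSymm)
    {c v : (Fin n → ℝ) → ℝ} (hc : ContDiffOn ℝ 2 c Ω) (hv : ContDiffOn ℝ 2 v Ω)
    {x : Fin n → ℝ} (hx : x ∈ Ω) (hcx : c x ≠ 0) :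
    diverg (fun y => γ y *ᵥ grad (fun z => c z * v z) y) x
      = v x * diverg (fun y => γ y *ᵥ grad c y) x
        + (c x)⁻¹ * diverg (fun y => c y ^ 2 • γ y *ᵥ grad v y) x := by
  have hxn := hΩ.mem_nhds hx
  have hcd {y} (hy : y ∈ Ω) : DifferentiableAt ℝ c y :=
    (hc.contDiffAt (hΩ.mem_nhds hy)).differentiableAt two_ne_zero
  have hvd {y} (hy : y ∈ Ω) : DifferentiableAt ℝ v y :=
    (hv.contDiffAt (hΩ.mem_nhds hy)).differentiableAt two_ne_zero
  have hC : DifferentiableAt ℝ (fun y => γ y *ᵥ grad c y) x :=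
    ((ContDiffOn.mulVec hγ (hc.grad hΩ)).contDiffAt hxn).differentiableAt one_ne_zero
  have hV : DifferentiableAt ℝ (fun y => γ y *ᵥ grad v y) x :=
    ((ContDiffOn.mulVec hγ (hv.grad hΩ)).contDiffAt hxn).differentiableAt one_ne_zero
  have hexp : (fun y => γ y *ᵥ grad (fun z => c z * v z) y) =ᶠ[𝓝 x]
      fun y => c y • γ y *ᵥ grad v y + v y • γ y *ᵥ grad c y :=
    mem_of_superset hxn fun y hy => by
      simp only [mem_ofPred_eq, grad_mul (hcd hy) (hvd hy), Matrix.mulVec_add, Matrix.mulVec_smul]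
  have hgrad : grad (fun y => c y ^ 2) x = (2 * c x) • grad c x := by
    simp only [pow_two, grad_mul (hcd hx) (hcd hx), two_mul, add_smul]
  have hswap : grad v x ⬝ᵥ γ x *ᵥ grad c x = grad c x ⬝ᵥ γ x *ᵥ grad v x := by
    rw [Matrix.dotProduct_mulVec, ← Matrix.mulVec_transpose, (hsymm x hx).eq, dotProduct_comm]
  rw [hexp.diverg_eq, diverg_add ((hcd hx).fun_smul hV) ((hvd hx).fun_smul hC),
    diverg_smul (hcd hx) hV, diverg_smul (hvd hx) hC, diverg_smul ((hcd hx).fun_pow 2) hV,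
    hgrad, hswap, smul_dotProduct, smul_eq_mul]
  field_simp
  ring

/-- Under the conformal rescaling equations, if `Ψ` is a smooth
diffeomorphism of the closure of `Ω` onto itself with `|det DΨ| = 1 + f` on `Ω`, then
`w := (cv) ∘ Ψ⁻¹` is a weak solution of `−div((Ψ_*γ)∇w) = λw` on `Ω`. -/
theorem conformal_rescaling_weak_solution
    {n : ℕ} (hn : 3 ≤ n) (Ω : Set (Fin n → ℝ)) (hΩo : IsOpen Ω)
    (hΩb : Bornology.IsBounded Ω)
    (γ : (Fin n → ℝ) → Matrix (Fin n) (Fin n) ℝ)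
    (hγ : IsConductivityOn γ (closure Ω))
    (hγC1 : ∀ i j, ContDiffOn ℝ 1 (fun x => γ x i j) (closure Ω))
    (lam : ℝ) (f : (Fin n → ℝ) → ℝ) (hf : ContinuousOn f Ω)
    (c v : (Fin n → ℝ) → ℝ)
    (hc : ContDiffOn ℝ 2 c (closure Ω)) (hv : ContDiffOn ℝ 2 v (closure Ω))
    (hcpos : ∀ x ∈ closure Ω, 0 < c x)
    (hveq : ∀ x ∈ Ω,
      -diverg (fun y => (c y ^ 2) • (γ y).mulVec (grad v y)) x = lam * v x)
    (hceq : ∀ x ∈ Ω,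
      diverg (fun y => (γ y).mulVec (grad c y)) x
        + lam * (c x - 1 / c x + c x * f x) = 0)
    (Ψ : DiffeoOn ⊤ Ω)
    (hdet : ∀ x ∈ Ω, |(Jac Ψ.toFun x).det| = 1 + f x) :
    ∀ φ : (Fin n → ℝ) → ℝ, IsTestFun Ω φ →
      ∫ y in Ω, (pushforward Ψ.toFun Ψ.invFun γ y).mulVec
          (grad (fun z => c (Ψ.invFun z) * v (Ψ.invFun z)) y) ⬝ᵥ grad φ y
        = lam * ∫ y in Ω, (c (Ψ.invFun y) * v (Ψ.invFun y)) * φ y := by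
  intro φ hφ
  have hγΩ i j := (hγC1 i j).mono subset_closure
  have hcΩ := hc.mono (subset_closure (s := Ω))
  have hvΩ := hv.mono (subset_closure (s := Ω))
  have hne : (⊤ : ℕ∞) ≠ 0 := by simp
  obtain ⟨hψ, hψc, hψs⟩ := Ψ.contDiff_indicator_comp hΩo hφ
  have hψeq : ∀ x ∈ Ω, Ω.indicator (fun x => φ (Ψ.toFun x)) x = φ (Ψ.toFun x) :=
    fun x hx => indicator_of_mem hx _
  have huΩ : ContDiffOn ℝ 2 (fun x => c x * v x) Ω := hcΩ.mul hvΩ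
  rw [Ψ.setIntegral_eq hne hΩo,
    Ψ.setIntegral_eq hne hΩo fun y => c (Ψ.invFun y) * v (Ψ.invFun y) * φ y, ← integral_const_mul]
  trans ∫ x in Ω, γ x *ᵥ grad (fun z => c z * v z) x
      ⬝ᵥ grad (Ω.indicator fun z => φ (Ψ.toFun z)) x
  · refine setIntegral_congr_fun hΩo.measurableSet fun x hx => ?_
    have hxn := hΩo.mem_nhds hx
    have hΨx := hΩo.mem_nhds (Ψ.apply_mem hx)
    have hw : DifferentiableAt ℝ (fun z => c (Ψ.invFun z) * v (Ψ.invFun z)) (Ψ.toFun x) := by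
      refine DifferentiableAt.comp (g := fun z => c z * v z) (Ψ.toFun x) ?_
        ((Ψ.contDiffAt_invFun hΩo (Ψ.apply_mem hx)).differentiableAt (by simp))
      rw [Ψ.left_inv x (subset_closure hx)]
      exact (huΩ.contDiffAt hxn).differentiableAt two_ne_zero
    have hwΨ : (fun z => c (Ψ.invFun (Ψ.toFun z)) * v (Ψ.invFun (Ψ.toFun z))) =ᶠ[𝓝 x]
        fun z => c z * v z := mem_of_superset hxn fun z hz => by
      simp only [mem_ofPred_eq, Ψ.left_inv z (subset_closure hz)]
    have hψx : (Ω.indicator fun z => φ (Ψ.toFun z)) =ᶠ[𝓝 x] fun z => φ (Ψ.toFun z) :=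
      mem_of_superset hxn hψeq
    rw [Ψ.abs_det_mul_pushforward_dotProduct hne hΩo γ hx hw
      (hφ.1.differentiable (by simp) _), hwΨ.grad_eq, hψx.grad_eq]
  · rw [setIntegral_dotProduct_grad hΩo (ContDiffOn.mulVec hγΩ (huΩ.grad hΩo))
      (hψ.of_le (by exact_mod_cast le_top)) hψc hψs, ← integral_neg]
    refine setIntegral_congr_fun hΩo.measurableSet fun x hx => ?_
    have hcx := (hcpos x (subset_closure hx)).ne'
    have hcdiv : diverg (fun y => γ y *ᵥ grad c y) x
        = -(lam * (c x - 1 / c x + c x * f x)) := by linarith [hceq x hx]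
    have hvdiv : diverg (fun y => c y ^ 2 • γ y *ᵥ grad v y) x = -(lam * v x) := by
      linarith [hveq x hx]
    simp only [hψeq x hx, hdet x hx, Ψ.left_inv x (subset_closure hx)]
    rw [diverg_mulVec_grad_mul hΩo hγΩ (fun y hy => (hγ.2 y (subset_closure hy)).1) hcΩ hvΩ
      hx hcx, hcdiv, hvdiv]
    field_simp
    ring
end
end
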